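/- Let H₁, …, H_k be harmonic functions on an open set Ω ⊆ ℂ and let V be subharmonic on Ω such that on every connected component U of Ω minus the support of ΔV, V coincides with some H_j. Then the support of ΔV is contained in the union over i ≠ j of the sets {z ∈ Ω : H_i(z) = H_j(z)}. -/

import Mathlib

open MeasureTheory Metric

/-- A function is harmonic on `s` if near each point of `s` it is the real part of a
holomorphic function. -/
def HarmonicOn (f : ℂ → ℝ) (s : Set ℂ) : Prop :=
  ∀ z ∈ s, ∃ ε > 0, ∃ g : ℂ → ℂ, DifferentiableOn ℂ g (ball z ε) ∧
    ∀ w ∈ ball z ε ∩ s, f w = (g w).re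

/-- Subharmonic: upper semicontinuous and satisfying the sub-mean-value inequality. -/
def SubharmonicOn (f : ℂ → ℝ) (s : Set ℂ) : Prop :=
  UpperSemicontinuousOn f s ∧
    ∀ z ∈ s, ∀ r > 0, closedBall z r ⊆ s →
      f z ≤ (1 / (2 * Real.pi)) * ∫ θ in (0:ℝ)..(2 * Real.pi),
        f (z + r * Complex.exp (θ * Complex.I))

open Filter Topology InnerProductSpace

theorem HarmonicOn.harmonicAt {f : ℂ → ℝ} {s : Set ℂ} {z : ℂ} (hf : HarmonicOn f s)
    (hs : s ∈ 𝓝 z) : HarmonicAt f z := by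
  obtain ⟨ε, hε, g, hg, hfg⟩ := hf z (mem_of_mem_nhds hs)
  have hball : ball z ε ∈ 𝓝 z := ball_mem_nhds z hε
  refine (harmonicAt_congr_nhds ?_).2 (hg.analyticAt hball).harmonicAt_re
  filter_upwards [hball, hs] with w hw hws using hfg w ⟨hw, hws⟩

theorem HarmonicOn.continuousAt {f : ℂ → ℝ} {s : Set ℂ} {z : ℂ} (hf : HarmonicOn f s)
    (hs : s ∈ 𝓝 z) : ContinuousAt f z :=
  (hf.harmonicAt hs).1.continuousAt

theorem HarmonicOn.congr_mono {f g : ℂ → ℝ} {s t : Set ℂ} (hf : HarmonicOn f s) (hts : t ⊆ s)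
    (hfg : ∀ w ∈ t, g w = f w) : HarmonicOn g t := by
  intro z hz
  obtain ⟨ε, hε, F, hF, h⟩ := hf z (hts hz)
  exact ⟨ε, hε, F, hF, fun w hw => (hfg w hw.2).trans (h w ⟨hw.1, hts hw.2⟩)⟩

theorem HarmonicOn.circleAverage_eq {f : ℂ → ℝ} {s : Set ℂ} (hs : IsOpen s)
    (hf : HarmonicOn f s) {c : ℂ} {r : ℝ} (hr : 0 < r) (hcr : closedBall c r ⊆ s) :
    Real.circleAverage f c r = f c := by
  apply InnerProductSpace.HarmonicOnNhd.circleAverage_eq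
  rw [abs_of_pos hr]
  exact fun w hw => hf.harmonicAt (hs.mem_nhds (hcr hw))

theorem SubharmonicOn.le_circleAverage {f : ℂ → ℝ} {s : Set ℂ} (hf : SubharmonicOn f s)
    {c : ℂ} {r : ℝ} (hr : 0 < r) (hcr : closedBall c r ⊆ s) :
    f c ≤ Real.circleAverage f c r := by
  have h := hf.2 c (hcr (mem_closedBall_self hr.le)) r hr hcr
  simpa [Real.circleAverage_def, circleMap] using h

theorem UpperSemicontinuousOn.le_of_mem_closure {f g : ℂ → ℝ} {s : Set ℂ} {z : ℂ}
    (hf : UpperSemicontinuousOn f s) (hz : z ∈ s) (hg : ContinuousAt g z)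
    (hcl : z ∈ closure {w ∈ s | f w = g w}) : g z ≤ f z := by
  by_contra! hlt
  obtain ⟨y, hfy, hyg⟩ := exists_between hlt
  have h1 : ∀ᶠ w in 𝓝 z, w ∈ s → f w < y := eventually_nhdsWithin_iff.1 (hf z hz y hfy)
  have h2 : ∀ᶠ w in 𝓝 z, y < g w := hg.eventually (lt_mem_nhds hyg)
  obtain ⟨w, ⟨hws, hw⟩, hw1, hw2⟩ := ((mem_closure_iff_frequently.1 hcl).and_eventually
    (h1.and h2)).exists
  linarith [hw1 hws]

/-- Almost every circle around a given centre meets a planar null set in a null set. -/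
theorem ae_ae_circleMap_notMem {K : Set ℂ} (hKcl : IsClosed K) (hK : volume K = 0) (c : ℂ) :
    ∀ᵐ r ∂(volume.restrict (Set.Ioi (0 : ℝ))),
      ∀ᵐ θ ∂(volume.restrict (Set.Ioc 0 (2 * Real.pi))), circleMap c r θ ∉ K := by
  set L : Set ℂ := (fun w => c - w) ⁻¹' K with hL
  have hLcl : IsClosed L := hKcl.preimage (by fun_prop)
  have hL0 : volume L = 0 := by
    rw [hL, (Measure.measurePreserving_sub_left volume c).measure_preimage
      hKcl.measurableSet.nullMeasurableSet, hK]
  have hpol := Complex.lintegral_comp_polarCoord_symm (L.indicator 1)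
  rw [lintegral_indicator_one hLcl.measurableSet, hL0, lintegral_eq_zero_iff'] at hpol
  swap
  · refine (Measurable.smul (f := fun p : ℝ × ℝ => ENNReal.ofReal p.1) (by fun_prop) ?_).aemeasurable
    refine (measurable_one.indicator hLcl.measurableSet).comp
      (f := fun p => Complex.polarCoord.symm p) ?_
    simp only [Complex.polarCoord_symm_apply]
    fun_prop
  have hprod : ∀ᵐ p ∂((volume.restrict (Set.Ioi (0 : ℝ))).prod
      (volume.restrict (Set.Ioo (-Real.pi) Real.pi))), circleMap c p.1 (p.2 + Real.pi) ∉ K := by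
    rw [Measure.prod_restrict, ← Measure.volume_eq_prod, ← Complex.polarCoord_target]
    filter_upwards [hpol, ae_restrict_mem Complex.polarCoord.open_target.measurableSet]
      with p hp hpt hpK
    have hp1 : 0 < p.1 := hpt.1
    have hmem : Complex.polarCoord.symm p ∈ L := by
      have : c - Complex.polarCoord.symm p = circleMap c p.1 (p.2 + Real.pi) := by
        rw [Complex.polarCoord_symm_apply, circleMap]
        push_cast
        rw [add_mul, Complex.exp_add, Complex.exp_pi_mul_I, Complex.exp_mul_I]
        ring
      rwa [hL, Set.mem_preimage, this]
    rw [Set.indicator_of_mem hmem] at hp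
    simp [hp1.not_ge] at hp
  filter_upwards [Measure.ae_ae_of_ae_prod hprod] with r hr
  rw [← Measure.restrict_congr_set Ioo_ae_eq_Ioc, ae_restrict_iff' measurableSet_Ioo]
  rw [ae_restrict_iff' measurableSet_Ioo] at hr
  have hshift := (measurePreserving_sub_right (volume : Measure ℝ)
    Real.pi).quasiMeasurePreserving.ae hr
  filter_upwards [hshift] with θ hθ hθI
  have := hθ ⟨by linarith [hθI.1], by linarith [hθI.2]⟩
  simpa using this

/-- A function which is continuous off a closed set `K` and takes there only values of finitely
many continuous functions is integrable along any circle almost disjoint from `K`. -/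
theorem circleIntegrable_of_ae_notMem {ι : Type*} [Fintype ι] {Ω K : Set ℂ} {V : ℂ → ℝ}
    {H : ι → ℂ → ℝ} (hKcl : IsClosed K) (hVc : ∀ w ∈ Ω \ K, ContinuousAt V w)
    (hHc : ∀ i, ∀ w ∈ Ω, ContinuousAt (H i) w) (hVH : ∀ w ∈ Ω \ K, ∃ i, V w = H i w)
    {c : ℂ} {r : ℝ} (hr : 0 < r) (hcr : closedBall c r ⊆ Ω)
    (hgood : ∀ᵐ θ ∂(volume.restrict (Set.Ioc 0 (2 * Real.pi))), circleMap c r θ ∉ K) :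
    CircleIntegrable V c r := by
  have hΩ : ∀ θ, circleMap c r θ ∈ Ω := fun θ =>
    hcr (sphere_subset_closedBall (circleMap_mem_sphere c hr.le θ))
  have hdom : Continuous fun θ => ∑ i, |H i (circleMap c r θ)| :=
    continuous_finsetSum _ fun i _ => (continuous_iff_continuousAt.2 fun θ =>
      (hHc i _ (hΩ θ)).comp (continuous_circleMap c r).continuousAt).abs
  have hopen : IsOpen {θ | circleMap c r θ ∉ K} :=
    hKcl.isOpen_compl.preimage (continuous_circleMap c r)
  have hmeas : AEStronglyMeasurable (fun θ => V (circleMap c r θ))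
      (volume.restrict (Set.Ioc 0 (2 * Real.pi))) := by
    rw [← Measure.restrict_eq_self_of_ae_mem hgood]
    refine ContinuousOn.aestronglyMeasurable (fun θ hθ => ?_) hopen.measurableSet
    exact ((hVc _ ⟨hΩ θ, hθ⟩).comp
      (continuous_circleMap c r).continuousAt).continuousWithinAt
  unfold CircleIntegrable
  rw [intervalIntegrable_iff_integrableOn_Ioc_of_le Real.two_pi_pos.le]
  refine Integrable.mono' (hdom.integrableOn_Ioc) hmeas ?_
  filter_upwards [hgood] with θ hθ
  obtain ⟨i, hi⟩ := hVH _ ⟨hΩ θ, hθ⟩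
  rw [hi, Real.norm_eq_abs]
  exact Finset.single_le_sum (f := fun i => |H i (circleMap c r θ)|)
    (fun _ _ => abs_nonneg _) (Finset.mem_univ i)

/-- If `f ≤ g` almost everywhere on a circle and the circle averages satisfy the opposite
inequality, then `f = g` almost everywhere on that circle. -/
theorem ae_eq_of_ae_le_of_circleAverage_le {f g : ℂ → ℝ} {c : ℂ} {r : ℝ}
    (hf : CircleIntegrable f c r) (hg : CircleIntegrable g c r)
    (hle : ∀ᵐ θ ∂(volume.restrict (Set.Ioc 0 (2 * Real.pi))),
      f (circleMap c r θ) ≤ g (circleMap c r θ))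
    (havg : Real.circleAverage g c r ≤ Real.circleAverage f c r) :
    ∀ᵐ θ ∂(volume.restrict (Set.Ioc 0 (2 * Real.pi))),
      f (circleMap c r θ) = g (circleMap c r θ) := by
  unfold CircleIntegrable at hf hg
  rw [Real.circleAverage_def, Real.circleAverage_def, smul_eq_mul, smul_eq_mul,
    mul_le_mul_iff_right₀ (inv_pos.2 Real.two_pi_pos),
    intervalIntegral.integral_of_le Real.two_pi_pos.le,
    intervalIntegral.integral_of_le Real.two_pi_pos.le] at havg
  rw [intervalIntegrable_iff_integrableOn_Ioc_of_le Real.two_pi_pos.le] at hf hg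
  exact (integral_eq_iff_of_ae_le hf hg hle).1 (le_antisymm (integral_mono_ae hf hg hle) havg)

theorem exists_circleMap_mem_Ioo {N : Set ℂ} (hN : IsOpen N) {c : ℂ} {r θ : ℝ}
    (hθ : θ ∈ Set.Ioc 0 (2 * Real.pi)) (h : circleMap c r θ ∈ N) :
    ∃ φ ∈ Set.Ioo 0 (2 * Real.pi), circleMap c r φ ∈ N := by
  have hcl : θ ∈ closure (Set.Ioo 0 (2 * Real.pi)) := by
    rw [closure_Ioo Real.two_pi_pos.ne]
    exact Set.Ioc_subset_Icc_self hθ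
  obtain ⟨φ, hφ, hφI⟩ := mem_closure_iff.1 hcl _ (hN.preimage (continuous_circleMap c r)) h
  exact ⟨φ, hφI, hφ⟩

/-- If a property holds almost everywhere on almost every small circle around `c`, then it holds
somewhere on each nonempty open subset of the punctured disc. -/
theorem exists_mem_of_ae_ae_circleMap {N : Set ℂ} (hN : IsOpen N) {c w : ℂ} {R : ℝ}
    (hw : w ∈ N) (hwR : w ∈ ball c R) (hwc : w ≠ c) {p : ℂ → Prop}
    (hp : ∀ᵐ r ∂(volume.restrict (Set.Ioi (0 : ℝ))), r < R →
      ∀ᵐ θ ∂(volume.restrict (Set.Ioc 0 (2 * Real.pi))), p (circleMap c r θ)) :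
    ∃ v ∈ N, p v := by
  have hρ : 0 < dist w c := dist_pos.2 hwc
  obtain ⟨θ, hθ, hθw⟩ : w ∈ circleMap c (dist w c) '' Set.Ioc 0 (2 * Real.pi) := by
    rw [image_circleMap_Ioc, abs_of_pos hρ]
    exact mem_sphere.2 rfl
  obtain ⟨φ, hφ, hφN⟩ := exists_circleMap_mem_Ioo hN hθ (hθw ▸ hw)
  have hcont : Continuous fun r : ℝ => circleMap c r φ := by
    unfold circleMap
    fun_prop
  have hopen : IsOpen ((fun r : ℝ => circleMap c r φ) ⁻¹' N ∩ Set.Ioo 0 R) :=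
    (hN.preimage hcont).inter isOpen_Ioo
  rw [ae_restrict_iff' measurableSet_Ioi] at hp
  obtain ⟨r, ⟨hrN, hr0, hrR⟩, hr⟩ := (Measure.dense_of_ae hp).inter_open_nonempty _ hopen
    ⟨dist w c, hφN, hρ, mem_ball.1 hwR⟩
  have hae := hr hr0 hrR
  rw [ae_restrict_iff' measurableSet_Ioc] at hae
  obtain ⟨ψ, ⟨hψN, hψI⟩, hψ⟩ := (Measure.dense_of_ae hae).inter_open_nonempty _
    ((hN.preimage (continuous_circleMap c r)).inter isOpen_Ioo) ⟨φ, hrN, hφ⟩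
  exact ⟨_, hψN, hψ (Set.Ioo_subset_Ioc_self hψI)⟩

/-- If `V` is piecewise harmonic with respect to `H₁, …, H_k` relative to the support `K`
of its distributional Laplacian, then `K ∩ Ω` is contained in `⋃_{i ≠ j} {H i = H j}`. -/
theorem support_subset_equality_sets (Ω K : Set ℂ) (hΩ : IsOpen Ω) (hconn : IsConnected Ω)
    (V : ℂ → ℝ) (hV : SubharmonicOn V Ω)
    (k : ℕ) (H : Fin k → ℂ → ℝ) (hH : ∀ i, HarmonicOn (H i) Ω)
    (hKcl : IsClosed K) (hKnull : volume K = 0)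
    -- K is the support of Δ V : its complement in Ω is the largest open set where V is harmonic
    (hKsupp : ∀ z ∈ Ω, (z ∈ K ↔ ¬ ∃ ε > 0, ball z ε ⊆ Ω ∧ HarmonicOn V (ball z ε)))
    -- V is piecewise harmonic: on each connected component of Ω \ K it equals some H j
    (hpw : ∀ z ∈ Ω \ K, ∃ j, ∀ w ∈ connectedComponentIn (Ω \ K) z, V w = H j w) :
    K ∩ Ω ⊆ {z | ∃ i j, i ≠ j ∧ H i z = H j z} := by
  rintro z ⟨hzK, hzΩ⟩
  by_contra hz
  have hne : ∀ i j, i ≠ j → H i z ≠ H j z := fun i j hij h => hz ⟨i, j, hij, h⟩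
  have hHc : ∀ i, ∀ w ∈ Ω, ContinuousAt (H i) w := fun i w hw =>
    (hH i).continuousAt (hΩ.mem_nhds hw)
  have hVH : ∀ w ∈ Ω \ K, ∃ i, V w = H i w := fun w hw => by
    obtain ⟨j, hj⟩ := hpw w hw
    exact ⟨j, hj w (mem_connectedComponentIn hw)⟩
  have hVc : ∀ w ∈ Ω \ K, ContinuousAt V w := fun w hw => by
    have h := (hKsupp w hw.1).not.1 hw.2
    rw [not_not] at h
    obtain ⟨ε, hε, -, h⟩ := h
    exact h.continuousAt (ball_mem_nhds w hε)
  have hdense : Dense Kᶜ := interior_eq_empty_iff_dense_compl.1 (Measure.interior_eq_empty_of_null hKnull)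
  have hzcl : z ∈ closure (⋃ i, {w ∈ Ω \ K | V w = H i w}) := by
    refine closure_mono ?_ (hdense.open_subset_closure_inter hΩ hzΩ)
    intro w hw
    obtain ⟨i, hi⟩ := hVH w hw
    exact Set.mem_iUnion.2 ⟨i, hw, hi⟩
  rw [closure_iUnion_of_finite] at hzcl
  obtain ⟨m, hm, hmax⟩ := Set.exists_max_image
    {i | z ∈ closure {w ∈ Ω \ K | V w = H i w}} (fun i => H i z) (Set.toFinite _)
    (Set.mem_iUnion.1 hzcl)
  have hmz : H m z ≤ V z := by
    refine hV.1.le_of_mem_closure hzΩ (hHc m z hzΩ) (closure_mono ?_ hm)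
    exact fun w hw => ⟨hw.1.1, hw.2⟩
  have hnear : ∀ i, ∀ᶠ w in 𝓝 z, w ∈ Ω \ K → V w = H i w → H i w ≤ H m w := by
    intro i
    by_cases hi : z ∈ closure {w ∈ Ω \ K | V w = H i w}
    · rcases eq_or_ne i m with rfl | him
      · exact Eventually.of_forall fun _ _ _ => le_rfl
      · filter_upwards [(hHc i z hzΩ).eventually_lt (hHc m z hzΩ)
          (lt_of_le_of_ne (hmax i hi) (hne i m him))] with w hw _ _ using hw.le
    · filter_upwards [isClosed_closure.isOpen_compl.mem_nhds hi] with w hw hwΩ hwV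
      exact absurd (subset_closure (show w ∈ {w ∈ Ω \ K | V w = H i w} from ⟨hwΩ, hwV⟩)) hw
  obtain ⟨R, hR, hball⟩ := Metric.eventually_nhds_iff_ball.1
    ((eventually_all.2 hnear).and (hΩ.mem_nhds hzΩ))
  have hBΩ : ball z R ⊆ Ω := fun w hw => (hball w hw).2
  have hVle : ∀ w ∈ ball z R \ K, V w ≤ H m w := fun w hw => by
    obtain ⟨i, hi⟩ := hVH w ⟨hBΩ hw.1, hw.2⟩
    exact hi.trans_le ((hball w hw.1).1 i ⟨hBΩ hw.1, hw.2⟩ hi)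
  have hoff : ∀ w ∈ ball z R \ K, V w = H m w := by
    by_contra! hcon
    obtain ⟨w, hw, hwne⟩ := hcon
    have hlt : V w < H m w := lt_of_le_of_ne (hVle w hw) hwne
    obtain ⟨N, hNlt, hNo, hwN⟩ := _root_.mem_nhds_iff.1 ((hVc w ⟨hBΩ hw.1, hw.2⟩).eventually_lt
      (hHc m w (hBΩ hw.1)) hlt)
    have hae : ∀ᵐ r ∂(volume.restrict (Set.Ioi (0 : ℝ))), r < R →
        ∀ᵐ θ ∂(volume.restrict (Set.Ioc 0 (2 * Real.pi))),
          V (circleMap z r θ) = H m (circleMap z r θ) := by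
      filter_upwards [ae_ae_circleMap_notMem hKcl hKnull z, ae_restrict_mem measurableSet_Ioi]
        with r hgood hr0 hrR
      have hr0 : 0 < r := hr0
      have hsub := closedBall_subset_ball (x := z) hrR
      have hcr := hsub.trans hBΩ
      refine ae_eq_of_ae_le_of_circleAverage_le
        (circleIntegrable_of_ae_notMem hKcl hVc hHc hVH hr0 hcr hgood)
        (ContinuousOn.circleIntegrable hr0.le fun v hv =>
          (hHc m v (hcr (sphere_subset_closedBall hv))).continuousWithinAt) ?_ ?_
      · filter_upwards [hgood] with θ hθ
        exact hVle _ ⟨hsub (sphere_subset_closedBall (circleMap_mem_sphere z hr0.le θ)), hθ⟩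
      · rw [(hH m).circleAverage_eq hΩ hr0 hcr]
        exact hmz.trans (hV.le_circleAverage hr0 hcr)
    obtain ⟨v, hvN, hv⟩ := exists_mem_of_ae_ae_circleMap (p := fun v => V v = H m v)
      hNo hwN hw.1 (fun h => hw.2 (h ▸ hzK)) hae
    have hvlt : V v < H m v := hNlt hvN
    exact hvlt.ne hv
  have hon : ∀ w ∈ ball z R, V w = H m w := by
    intro w hw
    apply le_antisymm
    · obtain ⟨δ, hδ, hsub⟩ := Metric.isOpen_iff.1 isOpen_ball w hw
      have hae := ae_ae_circleMap_notMem hKcl hKnull w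
      rw [ae_restrict_iff' measurableSet_Ioi] at hae
      obtain ⟨r, ⟨hr0, hrδ⟩, hr⟩ := (Measure.dense_of_ae hae).inter_open_nonempty (Set.Ioo 0 δ)
        isOpen_Ioo (Set.nonempty_Ioo.2 hδ)
      have hwr := (closedBall_subset_ball hrδ).trans hsub
      have hcr := hwr.trans hBΩ
      refine (hV.le_circleAverage hr0 hcr).trans_eq ?_
      rw [← (hH m).circleAverage_eq hΩ hr0 hcr, Real.circleAverage_def, Real.circleAverage_def,
        intervalIntegral.integral_of_le Real.two_pi_pos.le,
        intervalIntegral.integral_of_le Real.two_pi_pos.le]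
      congr 1
      apply integral_congr_ae
      filter_upwards [hr hr0] with θ hθ
      exact hoff _ ⟨hwr (sphere_subset_closedBall (circleMap_mem_sphere w hr0.le θ)), hθ⟩
    · refine hV.1.le_of_mem_closure (hBΩ hw) (hHc m w (hBΩ hw)) ?_
      refine closure_mono ?_ (hdense.open_subset_closure_inter isOpen_ball hw)
      exact fun v hv => ⟨hBΩ hv.1, hoff v hv⟩
  exact (hKsupp z hzΩ).1 hzK ⟨R, hR, hBΩ, (hH m).congr_mono hBΩ hon⟩
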